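/- arXiv:1103.3017 — 4 statements merged into one kernel-verified Lean document; each statement's English description precedes it below -/
import Mathlib

section
/- Let n ≥ 1 and let f : Z_2^n → Z_2 be a Boolean function. For every proper linear subspace W ⊊ Z_2^n (i.e., a Z_2-linear subspace with W ≠ Z_2^n), the Fourier weight of F outside W is at least the minimum influence: Σ_{u ∈ Z_2^n, u ∉ W} (F̂(u))² ≥ γ_f. -/
/-- The influence of `v` over `f`: `γ_{f,v} = |{x : f(x) ≠ f(x+v)}| / 2^n`. -/
noncomputable def influence (n : ℕ) (f : (Fin n → ZMod 2) → ZMod 2)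
    (v : Fin n → ZMod 2) : ℝ :=
  ((Finset.univ.filter fun x : Fin n → ZMod 2 => f x ≠ f (x + v)).card : ℝ) / 2 ^ n

/-- The minimum influence over `f`: `γ_f = min_{v ≠ 0} γ_{f,v}`. -/
noncomputable def minInfluence (n : ℕ) (hn : 1 ≤ n)
    (f : (Fin n → ZMod 2) → ZMod 2) : ℝ :=
  (Finset.univ.filter fun v : Fin n → ZMod 2 => v ≠ 0).inf'
    (Finset.filter_nonempty_iff.mpr
      ⟨fun _ => 1, Finset.mem_univ _, fun h => by simpa using congrFun h ⟨0, hn⟩⟩)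
    (influence n f)

/-- The sign `(-1)^a` of a residue `a` modulo two. -/
noncomputable def zmodSign (a : ZMod 2) : ℝ := (-1) ^ a.val

theorem zmodSign_zero : zmodSign 0 = 1 := by simp [zmodSign]

theorem zmodSign_one : zmodSign 1 = -1 := by simp [zmodSign, ZMod.val_one]

theorem ZMod.two_eq_zero_or_one (a : ZMod 2) : a = 0 ∨ a = 1 := by
  revert a; decide

theorem zmodSign_add (a b : ZMod 2) : zmodSign (a + b) = zmodSign a * zmodSign b := by
  have h : (1 + 1 : ZMod 2) = 0 := by decide
  rcases a.two_eq_zero_or_one with rfl | rfl <;> rcases b.two_eq_zero_or_one with rfl | rfl <;>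
    simp [h, zmodSign_zero, zmodSign_one]

theorem zmodSign_mul_zmodSign (a b : ZMod 2) :
    zmodSign a * zmodSign b = 1 - 2 * if a ≠ b then 1 else 0 := by
  rcases a.two_eq_zero_or_one with rfl | rfl <;> rcases b.two_eq_zero_or_one with rfl | rfl <;>
    norm_num [zmodSign_zero, zmodSign_one]

theorem sum_zmodSign_dotProduct {n : ℕ} (z : Fin n → ZMod 2) :
    ∑ u : Fin n → ZMod 2, zmodSign (u ⬝ᵥ z) = if z = 0 then 2 ^ n else 0 := by
  split_ifs with hz
  · simp [hz, zmodSign_zero]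
  · obtain ⟨i, hi⟩ := Function.ne_iff.mp hz
    have hi : z i = 1 := (z i).two_eq_zero_or_one.resolve_left hi
    have h := Equiv.sum_comp (Equiv.addRight (Pi.single i (1 : ZMod 2)))
      fun u : Fin n → ZMod 2 => zmodSign (u ⬝ᵥ z)
    simp only [Equiv.coe_addRight, add_dotProduct, single_dotProduct, hi, one_mul, zmodSign_add,
      zmodSign_one, mul_neg_one, Finset.sum_neg_distrib] at h
    linarith

/-- The Fourier coefficient at `u` of the sign function of `f`. -/
noncomputable def signFourier {n : ℕ} (f : (Fin n → ZMod 2) → ZMod 2)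
    (u : Fin n → ZMod 2) : ℝ :=
  (2 ^ n)⁻¹ * ∑ x, zmodSign (f x) * zmodSign (u ⬝ᵥ x)

theorem sum_signFourier_sq_mul {n : ℕ} (f : (Fin n → ZMod 2) → ZMod 2)
    (v : Fin n → ZMod 2) :
    ∑ u, signFourier f u ^ 2 * zmodSign (u ⬝ᵥ v) =
      (2 ^ n)⁻¹ * ∑ x, zmodSign (f x) * zmodSign (f (x + v)) := by
  have expand (u : Fin n → ZMod 2) : signFourier f u ^ 2 * zmodSign (u ⬝ᵥ v) =
      ((2 ^ n)⁻¹) ^ 2 * ∑ x, ∑ y, zmodSign (f x) * zmodSign (f y) *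
        zmodSign (u ⬝ᵥ (x + v + y)) := by
    rw [signFourier, mul_pow, mul_assoc, sq (∑ x, _), Finset.sum_mul_sum, Finset.sum_mul]
    simp only [Finset.sum_mul, dotProduct_add, zmodSign_add]
    congr 1
    refine Finset.sum_congr rfl fun x _ => Finset.sum_congr rfl fun y _ => ?_
    ring
  have eq_zero_iff (x y : Fin n → ZMod 2) : x + v + y = 0 ↔ x + v = y := by
    rw [add_eq_zero_iff_eq_neg, show -y = y from funext fun i => ZMod.neg_eq_self_mod_two (y i)]
  simp only [expand]
  rw [← Finset.mul_sum, Finset.sum_comm, sq, mul_assoc]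
  congr 1
  rw [Finset.mul_sum]
  refine Finset.sum_congr rfl fun x _ => ?_
  rw [Finset.sum_comm]
  simp only [← Finset.mul_sum, sum_zmodSign_dotProduct, eq_zero_iff]
  simp only [mul_ite, mul_zero, Finset.sum_ite_eq, Finset.mem_univ, if_true]
  field_simp

theorem mean_zmodSign_mul_eq_one_sub_influence {n : ℕ} (f : (Fin n → ZMod 2) → ZMod 2)
    (v : Fin n → ZMod 2) :
    (2 ^ n)⁻¹ * ∑ x, zmodSign (f x) * zmodSign (f (x + v)) = 1 - 2 * influence n f v := by
  simp only [zmodSign_mul_zmodSign, Finset.sum_sub_distrib, ← Finset.mul_sum, Finset.sum_boole,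
    influence]
  simp
  field_simp

theorem sum_signFourier_sq_mul_eq_influence {n : ℕ} (f : (Fin n → ZMod 2) → ZMod 2)
    (v : Fin n → ZMod 2) :
    ∑ u, signFourier f u ^ 2 * ((1 - zmodSign (u ⬝ᵥ v)) / 2) = influence n f v := by
  have h₀ := (sum_signFourier_sq_mul f 0).trans (mean_zmodSign_mul_eq_one_sub_influence f 0)
  have hv := (sum_signFourier_sq_mul f v).trans (mean_zmodSign_mul_eq_one_sub_influence f v)
  have h : influence n f 0 = 0 := by simp [influence]
  simp only [dotProduct_zero, zmodSign_zero, mul_one, h] at h₀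
  simp only [mul_div_assoc', mul_sub, mul_one]
  rw [← Finset.sum_div, Finset.sum_sub_distrib, h₀, hv]
  ring

theorem Submodule.exists_ne_zero_forall_dotProduct_eq_zero {K ι : Type*} [Field K] [Fintype ι]
    (W : Submodule K (ι → K)) (hW : W ≠ ⊤) : ∃ v ≠ 0, ∀ u ∈ W, u ⬝ᵥ v = 0 := by
  classical
  obtain ⟨φ, hφ, hle⟩ := W.exists_le_ker_of_lt_top hW.lt_top
  have happly (u : ι → K) : φ u = u ⬝ᵥ fun i => φ (Pi.single i 1) := by
    rw [φ.pi_apply_eq_sum_univ u]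
    refine Finset.sum_congr rfl fun i _ => congrArg (u i * φ ·) (funext fun j => ?_)
    simp [Pi.single_apply, eq_comm]
  refine ⟨fun i => φ (Pi.single i 1), fun h => hφ ?_, fun u hu => ?_⟩
  · refine LinearMap.ext fun u => ?_
    rw [happly u, h, dotProduct_zero, LinearMap.zero_apply]
  · rw [← happly u]
    exact hle hu

open scoped Classical in
/-- For every proper `Z_2`-linear subspace `W ⊊ Z_2^n`, the Fourier weight of
`F(x) = (-1)^{f(x)}` outside `W` is at least the minimum influence `γ_f`. -/
theorem fourier_weight_outside_proper_subspace (n : ℕ) (hn : 1 ≤ n)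
    (f : (Fin n → ZMod 2) → ZMod 2)
    (W : Submodule (ZMod 2) (Fin n → ZMod 2)) (hW : W ≠ ⊤) :
    ∑ u ∈ Finset.univ.filter fun u : Fin n → ZMod 2 => u ∉ W,
        ((2 ^ n : ℝ)⁻¹ *
          ∑ x : Fin n → ZMod 2,
            (-1 : ℝ) ^ (f x).val * (-1 : ℝ) ^ (∑ i, u i * x i : ZMod 2).val) ^ 2 ≥
      minInfluence n hn f := by
  obtain ⟨v, hv, hvW⟩ := W.exists_ne_zero_forall_dotProduct_eq_zero hW
  change minInfluence n hn f ≤ ∑ u with u ∉ W, signFourier f u ^ 2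
  calc
    minInfluence n hn f ≤ influence n f v := Finset.inf'_le _ (by simpa using hv)
    _ = ∑ u, signFourier f u ^ 2 * ((1 - zmodSign (u ⬝ᵥ v)) / 2) :=
      (sum_signFourier_sq_mul_eq_influence f v).symm
    _ ≤ ∑ u with u ∉ W, signFourier f u ^ 2 := by
      rw [Finset.sum_filter]
      refine Finset.sum_le_sum fun u _ => ?_
      by_cases hu : u ∈ W
      · simp [hu, hvW u hu, zmodSign_zero]
      · rw [if_pos hu]
        refine mul_le_of_le_one_right (sq_nonneg (signFourier f u)) ?_
        rcases (u ⬝ᵥ v).two_eq_zero_or_one with h | h <;>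
          norm_num [h, zmodSign_zero, zmodSign_one]
end

section
/- Let n ≥ 1, let f : Z_2^n → Z_2, let s ∈ Z_2^n, and define g : Z_2^n → Z_2 by g(x) = f(x+s). Then for every b ∈ Z_2 and every u ∈ Z_2^n, the amplitude of the sampling subroutine satisfies: 2^{−n} Σ_{x ∈ Z_2^n, f(x) ⊕ g(x) = b} (−1)^{f(x)}·(−1)^{⟨u,x⟩} = ((1 + (−1)^{b}·(−1)^{⟨u,s⟩})/2)·F̂(u). -/
/-- The sign character `a ↦ (-1)^a` of `ZMod 2` is multiplicative. -/
lemma neg_one_pow_val_add (a b : ZMod 2) :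
    (-1 : ℝ) ^ (a + b).val = (-1 : ℝ) ^ a.val * (-1 : ℝ) ^ b.val := by
  rw [ZMod.val_add, ← neg_one_pow_eq_pow_mod_two, pow_add]

/-- Projecting onto `a + c = b` by averaging over the characters of `ZMod 2`. -/
lemma ite_add_eq_mul_neg_one_pow_val (a b c : ZMod 2) (t : ℝ) :
    (if a + c = b then (-1 : ℝ) ^ a.val * t else 0) =
      ((-1 : ℝ) ^ a.val * t + (-1 : ℝ) ^ b.val * ((-1 : ℝ) ^ c.val * t)) / 2 := by
  have eq_zero_or_one : ∀ z : ZMod 2, z = 0 ∨ z = 1 := by decide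
  have one_add_one : (1 : ZMod 2) + 1 = 0 := by decide
  have val_one : (1 : ZMod 2).val = 1 := rfl
  rcases eq_zero_or_one a with rfl | rfl <;> rcases eq_zero_or_one b with rfl | rfl <;>
    rcases eq_zero_or_one c with rfl | rfl <;> simp [one_add_one, val_one]

/-- Translating the argument by `s` multiplies the Fourier coefficient at `u` by `(-1)^⟨u,s⟩`. -/
lemma sum_translate_neg_one_pow_val {n : ℕ} (F : (Fin n → ZMod 2) → ℝ) (s u : Fin n → ZMod 2) :
    ∑ x, F (x + s) * (-1 : ℝ) ^ (∑ i, u i * x i : ZMod 2).val =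
      (-1 : ℝ) ^ (∑ i, u i * s i : ZMod 2).val *
        ∑ x, F x * (-1 : ℝ) ^ (∑ i, u i * x i : ZMod 2).val := by
  rw [Finset.mul_sum]
  refine Fintype.sum_equiv (Equiv.addRight s) _ _ fun x => ?_
  have inner_add : ∑ i, u i * (x + s) i = ∑ i, u i * x i + ∑ i, u i * s i := by
    simp [mul_add, Finset.sum_add_distrib]
  have sq_eq_one : (-1 : ℝ) ^ (∑ i, u i * s i : ZMod 2).val *
      (-1 : ℝ) ^ (∑ i, u i * s i : ZMod 2).val = 1 := by
    rw [← mul_pow]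
    norm_num
  rw [Equiv.coe_addRight, inner_add, neg_one_pow_val_add]
  linear_combination
    -(F (x + s) * (-1 : ℝ) ^ (∑ i, u i * x i : ZMod 2).val) * sq_eq_one


/-- If `g(x) = f(x+s)`, then for every `b ∈ Z_2` and `u ∈ Z_2^n` the amplitude
of the basis state `|b⟩|u⟩` at the end of the quantum sampling subroutine is
`2^{-n} ∑_{x : f(x)⊕g(x)=b} (-1)^{f(x)} (-1)^{⟨u,x⟩} = ((1 + (-1)^b (-1)^{⟨u,s⟩})/2) · F̂(u)`. -/
theorem sampling_amplitude (n : ℕ) (hn : 1 ≤ n)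
    (f g : (Fin n → ZMod 2) → ZMod 2) (s : Fin n → ZMod 2)
    (hg : ∀ x, g x = f (x + s)) (b : ZMod 2) (u : Fin n → ZMod 2) :
    (2 ^ n : ℝ)⁻¹ *
        ∑ x ∈ Finset.univ.filter fun x : Fin n → ZMod 2 => f x + g x = b,
          (-1 : ℝ) ^ (f x).val * (-1 : ℝ) ^ (∑ i, u i * x i : ZMod 2).val =
      ((1 + (-1 : ℝ) ^ b.val * (-1 : ℝ) ^ (∑ i, u i * s i : ZMod 2).val) / 2) *
        ((2 ^ n : ℝ)⁻¹ *
          ∑ x : Fin n → ZMod 2,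
            (-1 : ℝ) ^ (f x).val * (-1 : ℝ) ^ (∑ i, u i * x i : ZMod 2).val) := by
  simp only [Finset.sum_filter, ite_add_eq_mul_neg_one_pow_val, hg]
  rw [← Finset.sum_div, Finset.sum_add_distrib, ← Finset.mul_sum,
    sum_translate_neg_one_pow_val fun x => (-1 : ℝ) ^ (f x).val]
  ring
end

section
/- Let n ≥ 1, let f : Z_2^n → Z_2, let s ∈ Z_2^n, and define g : Z_2^n → Z_2 by g(x) = f(x+s). Then for every u ∈ Z_2^n, the total probability of measuring u in the second register of the sampling subroutine is the squared Fourier coefficient of F: Σ_{b ∈ {0,1}} ( 2^{−n} Σ_{x ∈ Z_2^n, f(x) ⊕ g(x) = b} (−1)^{f(x)}·(−1)^{⟨u,x⟩} )² = (F̂(u))². In particular this marginal distribution does not depend on the shift s. -/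
/-- Translation by `s` preserves the level set `f x + f (x + s) = b` and multiplies the signed
character sum over it by `(-1)^(b + ⟨u, s⟩)`. -/
lemma levelSet_charSum_eq_sign_mul {n : ℕ} (f : (Fin n → ZMod 2) → ZMod 2)
    (s u : Fin n → ZMod 2) (b : ZMod 2) :
    ∑ x : Fin n → ZMod 2 with f x + f (x + s) = b,
        (-1 : ℝ) ^ (f x).val * (-1 : ℝ) ^ (∑ i, u i * x i : ZMod 2).val =
      (-1 : ℝ) ^ b.val * (-1 : ℝ) ^ (∑ i, u i * s i : ZMod 2).val *
        ∑ x : Fin n → ZMod 2 with f x + f (x + s) = b,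
          (-1 : ℝ) ^ (f x).val * (-1 : ℝ) ^ (∑ i, u i * x i : ZMod 2).val := by
  have hss : ∀ x : Fin n → ZMod 2, x + s + s = x := fun x => funext fun i => by
    simp only [Pi.add_apply]
    rw [add_assoc, CharTwo.add_self_eq_zero, add_zero]
  rw [Finset.mul_sum]
  refine Finset.sum_bij' (fun x _ => x + s) (fun x _ => x + s) ?_ ?_
    (fun x _ => hss x) (fun x _ => hss x) ?_
  · intro x hx
    simpa only [Finset.mem_filter_univ, hss, add_comm (f (x + s))] using hx
  · intro x hx
    simpa only [Finset.mem_filter_univ, hss, add_comm (f (x + s))] using hx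
  · intro x hx
    have hb : f x + f (x + s) = b := by simpa using hx
    have hf : f x = b + f (x + s) := by
      rw [← hb, add_assoc, CharTwo.add_self_eq_zero, add_zero]
    have hu : (∑ i, u i * x i) = (∑ i, u i * s i) + ∑ i, u i * (x + s) i := by
      rw [← Finset.sum_add_distrib]
      refine Finset.sum_congr rfl fun i _ => ?_
      rw [← mul_add, add_comm (s i)]
      exact congrArg (u i * ·) (congrFun (hss x) i).symm
    rw [hu, hf, neg_one_pow_val_add, neg_one_pow_val_add]
    ring

/-- If `g(x) = f(x+s)`, then for every `u ∈ Z_2^n` the total probability of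
measuring `u` in the second register of the sampling subroutine is
`∑_{b ∈ Z_2} (2^{-n} ∑_{x : f(x)⊕g(x)=b} (-1)^{f(x)} (-1)^{⟨u,x⟩})² = (F̂(u))²`;
in particular this marginal distribution does not depend on the shift `s`. -/
theorem marginal_distribution_is_fourier_weight (n : ℕ) (hn : 1 ≤ n)
    (f g : (Fin n → ZMod 2) → ZMod 2) (s : Fin n → ZMod 2)
    (hg : ∀ x, g x = f (x + s)) (u : Fin n → ZMod 2) :
    ∑ b : ZMod 2,
        ((2 ^ n : ℝ)⁻¹ *
          ∑ x ∈ Finset.univ.filter fun x : Fin n → ZMod 2 => f x + g x = b,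
            (-1 : ℝ) ^ (f x).val * (-1 : ℝ) ^ (∑ i, u i * x i : ZMod 2).val) ^ 2 =
      ((2 ^ n : ℝ)⁻¹ *
        ∑ x : Fin n → ZMod 2,
          (-1 : ℝ) ^ (f x).val * (-1 : ℝ) ^ (∑ i, u i * x i : ZMod 2).val) ^ 2 := by
  obtain rfl : g = fun x => f (x + s) := funext hg
  have key := levelSet_charSum_eq_sign_mul f s u
  have htotal := Finset.sum_fiberwise (Finset.univ : Finset (Fin n → ZMod 2))
    (fun x => f x + f (x + s))
    (fun x => (-1 : ℝ) ^ (f x).val * (-1 : ℝ) ^ (∑ i, u i * x i : ZMod 2).val)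
  rw [← htotal]
  have h0 := key 0
  have h1 := key 1
  have huniv : (Finset.univ : Finset (ZMod 2)) = {0, 1} := rfl
  rw [huniv, Finset.sum_pair zero_ne_one, Finset.sum_pair zero_ne_one]
  rw [ZMod.val_zero, pow_zero, one_mul] at h0
  rw [ZMod.val_one, pow_one] at h1
  rcases neg_one_pow_eq_or ℝ (∑ i, u i * s i : ZMod 2).val with hs | hs <;> rw [hs] at h0 h1
  · have hzero := self_eq_neg.mp (h1.trans (by ring))
    rw [hzero]
    ring
  · have hzero := self_eq_neg.mp (h0.trans (by ring))
    rw [hzero]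
    ring
end

section
/- Let n ≥ 1. If f : Z_2^n → Z_2 is chosen uniformly at random among all Boolean functions on Z_2^n, then the probability that the minimum influence of f is less than 1/3 satisfies Pr_f[γ_f < 1/3] ≤ 2^n · exp(−2^{n−1}/18). In particular, a uniformly random Boolean function has minimum influence at least 1/3 except with probability exponentially small in 2^n. -/
/-- The real-valued sign character of `ZMod 2`. -/
noncomputable def zmodTwoSign (a : ZMod 2) : ℝ := if a = 0 then 1 else -1

lemma add_add_cancel_zmodTwo {n : ℕ} (x v : Fin n → ZMod 2) : x + v + v = x := by
  funext j
  simp [add_assoc, CharTwo.add_self_eq_zero]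

/-- Splitting a sum over `Z_2^n` along the hyperplane `x i = 0`, when `v i ≠ 0`. -/
lemma sum_eq_sum_hyperplane_add_translate {n : ℕ} {v : Fin n → ZMod 2} {i : Fin n}
    (hv : v i = 1) (F : (Fin n → ZMod 2) → ℝ) :
    ∑ x, F x = ∑ x with x i = 0, (F x + F (x + v)) := by
  rw [← Finset.sum_filter_add_sum_filter_not Finset.univ (fun x : Fin n → ZMod 2 => x i = 0),
    Finset.sum_add_distrib]
  congr 1
  have hz : ∀ a : ZMod 2, (a + 1 = 0 ↔ ¬ a = 0) := by decide
  refine Finset.sum_bij' (fun x _ => x + v) (fun x _ => x + v) ?_ ?_ ?_ ?_ ?_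
  · intro x hx
    simpa [hv, hz] using hx
  · intro x hx
    simpa [hv, hz] using hx
  all_goals
    intro x _
    simp only [add_add_cancel_zmodTwo]

lemma card_hyperplane {k : ℕ} (i : Fin (k + 1)) :
    (Finset.univ.filter fun x : Fin (k + 1) → ZMod 2 => x i = 0).card = 2 ^ k := by
  have h := sum_eq_sum_hyperplane_add_translate (v := fun _ => 1) (i := i) rfl (fun _ => 1)
  simp only [Finset.sum_const, nsmul_eq_mul, mul_one, Finset.card_univ, Fintype.card_pi,
    ZMod.card, Finset.prod_const, Fintype.card_fin, pow_succ] at h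
  push_cast at h
  have hcard : (((Finset.univ.filter fun x : Fin (k + 1) → ZMod 2 => x i = 0).card : ℕ) : ℝ)
      = 2 ^ k := by linarith
  exact_mod_cast hcard

/-- Adding to `f`, on the hyperplane `x i = 0`, its translate by `v` is an involution. -/
def addTranslateOnHyperplane {n : ℕ} (v : Fin n → ZMod 2) (i : Fin n) (hv : v i = 1) :
    Equiv.Perm ((Fin n → ZMod 2) → ZMod 2) :=
  Function.Involutive.toPerm (fun f x => if x i = 0 then f x + f (x + v) else f x) (by
    intro f
    funext x
    by_cases hx : x i = 0
    · simp [hx, hv, add_assoc, CharTwo.add_self_eq_zero]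
    · simp [hx])

/-- The exponential moment of the autocorrelation of a random Boolean function. -/
lemma sum_exp_autocorrelation {k : ℕ} (v : Fin (k + 1) → ZMod 2) (i : Fin (k + 1))
    (hv : v i = 1) (s : ℝ) :
    ∑ f : (Fin (k + 1) → ZMod 2) → ZMod 2,
        Real.exp (s * ∑ x with x i = 0, zmodTwoSign (f x + f (x + v))) =
      2 ^ 2 ^ (k + 1) * Real.cosh s ^ 2 ^ k := by
  have hcomp : ∀ f : (Fin (k + 1) → ZMod 2) → ZMod 2,
      Real.exp (s * ∑ x with x i = 0, zmodTwoSign (f x + f (x + v))) =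
        ∏ x, if x i = 0 then Real.exp (s * zmodTwoSign (addTranslateOnHyperplane v i hv f x))
          else 1 := by
    intro f
    rw [Finset.mul_sum, Real.exp_sum, Finset.prod_filter]
    refine Finset.prod_congr rfl fun x _ => ?_
    by_cases hx : x i = 0 <;> simp [hx, addTranslateOnHyperplane,
      Function.Involutive.toPerm]
  simp_rw [hcomp]
  rw [Equiv.sum_comp (addTranslateOnHyperplane v i hv)
    (fun h => ∏ x, if x i = 0 then Real.exp (s * zmodTwoSign (h x)) else 1),
    ← Fintype.prod_sum
      (fun (x : Fin (k + 1) → ZMod 2) a => if x i = 0 then Real.exp (s * zmodTwoSign a) else 1)]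
  have hfac : ∀ x : Fin (k + 1) → ZMod 2,
      (∑ a : ZMod 2, if x i = 0 then Real.exp (s * zmodTwoSign a) else 1) =
        2 * if x i = 0 then Real.cosh s else 1 := by
    intro x
    have huniv : (Finset.univ : Finset (ZMod 2)) = {0, 1} := by decide
    by_cases hx : x i = 0
    · simp [hx, huniv, zmodTwoSign, Real.cosh_eq]
      ring
    · simp [hx]
  simp_rw [hfac]
  rw [Finset.prod_mul_distrib, ← Finset.prod_filter, Finset.prod_const, Finset.prod_const,
    card_hyperplane]
  simp

/-- A small influence forces a large autocorrelation. -/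
lemma autocorrelation_gt_of_influence_lt {k : ℕ} {v : Fin (k + 1) → ZMod 2} {i : Fin (k + 1)}
    (hv : v i = 1) {f : (Fin (k + 1) → ZMod 2) → ZMod 2} (hf : influence (k + 1) f v < 1 / 3) :
    (2 : ℝ) ^ k / 3 < ∑ x with x i = 0, zmodTwoSign (f x + f (x + v)) := by
  have hsplit := sum_eq_sum_hyperplane_add_translate hv
    (fun x => zmodTwoSign (f x + f (x + v)))
  have hsymm : ∀ x, zmodTwoSign (f (x + v) + f (x + v + v)) = zmodTwoSign (f x + f (x + v)) := by
    intro x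
    rw [add_add_cancel_zmodTwo, add_comm]
  simp_rw [hsymm, ← two_mul] at hsplit
  rw [← Finset.mul_sum] at hsplit
  have hsign : ∀ a b : ZMod 2, zmodTwoSign (a + b) = 1 - 2 * if a ≠ b then 1 else 0 := by
    intro a b
    have hab : a + b = 0 ↔ a = b := CharTwo.add_eq_zero
    by_cases h : a = b
    · simp [zmodTwoSign, h, CharTwo.add_self_eq_zero]
    · simp [zmodTwoSign, hab, h]
      norm_num
  have hcard : ∑ x, zmodTwoSign (f x + f (x + v)) = 2 ^ (k + 1) -
      2 * ((Finset.univ.filter fun x : Fin (k + 1) → ZMod 2 => f x ≠ f (x + v)).card : ℝ) := by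
    simp_rw [hsign]
    rw [Finset.sum_sub_distrib, ← Finset.mul_sum, Finset.sum_boole]
    simp
  rw [influence, div_lt_iff₀ (by positivity)] at hf
  rw [pow_succ] at hf hcard
  linarith

open scoped Classical in
/-- Hoeffding's bound for the influence of a fixed nonzero direction. -/
lemma card_influence_lt_le {k : ℕ} {v : Fin (k + 1) → ZMod 2} (hv : v ≠ 0) :
    ((Finset.univ.filter fun f => influence (k + 1) f v < 1 / 3).card : ℝ) ≤
      2 ^ 2 ^ (k + 1) * Real.exp (-(2 : ℝ) ^ k / 18) := by
  obtain ⟨i, hi⟩ := Function.ne_iff.mp hv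
  have hz : ∀ a : ZMod 2, a ≠ 0 → a = 1 := by decide
  have hi1 : v i = 1 := hz _ hi
  set S := Finset.univ.filter fun f => influence (k + 1) f v < 1 / 3
  have hmarkov : (S.card : ℝ) * Real.exp ((2 : ℝ) ^ k / 9) ≤
      2 ^ 2 ^ (k + 1) * Real.cosh (1 / 3) ^ 2 ^ k := by
    rw [← sum_exp_autocorrelation v i hi1, ← nsmul_eq_mul]
    refine (Finset.card_nsmul_le_sum S _ _ fun f hf => ?_).trans
      (Finset.sum_le_sum_of_subset_of_nonneg (Finset.subset_univ S)
        fun f _ _ => (Real.exp_pos _).le)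
    have := autocorrelation_gt_of_influence_lt hi1 (Finset.mem_filter.mp hf).2
    exact Real.exp_le_exp.mpr (by linarith)
  have hcosh : Real.cosh (1 / 3) ^ 2 ^ k ≤ Real.exp ((2 : ℝ) ^ k / 18) := by
    calc Real.cosh (1 / 3) ^ 2 ^ k ≤ Real.exp ((1 / 3) ^ 2 / 2) ^ 2 ^ k :=
          pow_le_pow_left₀ (Real.cosh_pos _).le (Real.cosh_le_exp_half_sq _) _
      _ = Real.exp ((2 : ℝ) ^ k / 18) := by
          rw [← Real.exp_nat_mul]
          congr 1
          push_cast
          ring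
  refine le_of_mul_le_mul_right ?_ (Real.exp_pos ((2 : ℝ) ^ k / 9))
  calc _ ≤ _ := hmarkov
    _ ≤ 2 ^ 2 ^ (k + 1) * Real.exp ((2 : ℝ) ^ k / 18) := by gcongr
    _ = _ := by
      rw [mul_assoc, ← Real.exp_add]
      congr 2
      ring


open scoped Classical in
/-- If `f : Z_2^n → Z_2` is chosen uniformly at random among all Boolean
functions, then `Pr_f[γ_f < 1/3] ≤ 2^n · exp(−2^{n−1}/18)`, so a random Boolean function has
minimum influence at least `1/3` except with probability exponentially small in `2^n`. -/
theorem random_function_min_influence_large (n : ℕ) (hn : 1 ≤ n) :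
    (((Finset.univ : Finset ((Fin n → ZMod 2) → ZMod 2)).filter fun f =>
          minInfluence n hn f < 1 / 3).card : ℝ) / 2 ^ 2 ^ n ≤
      2 ^ n * Real.exp (-(2 : ℝ) ^ (n - 1) / 18) := by
  obtain ⟨k, rfl⟩ : ∃ k, n = k + 1 := ⟨n - 1, by omega⟩
  rw [Nat.add_sub_cancel, div_le_iff₀ (by positivity)]
  have hsub : (Finset.univ.filter fun f => minInfluence (k + 1) hn f < 1 / 3) ⊆
      (Finset.univ.filter fun v : Fin (k + 1) → ZMod 2 => v ≠ 0).biUnion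
        fun v => Finset.univ.filter fun f => influence (k + 1) f v < 1 / 3 := by
    intro f hf
    obtain ⟨v, hv, hlt⟩ := (Finset.inf'_lt_iff _).mp (Finset.mem_filter.mp hf).2
    exact Finset.mem_biUnion.mpr ⟨v, hv, Finset.mem_filter.mpr ⟨Finset.mem_univ _, hlt⟩⟩
  have hdirs : ((Finset.univ.filter fun v : Fin (k + 1) → ZMod 2 => v ≠ 0).card : ℝ) ≤
      2 ^ (k + 1) := by
    have h := Finset.card_filter_le Finset.univ (fun v : Fin (k + 1) → ZMod 2 => v ≠ 0)
    rw [Finset.card_univ, Fintype.card_fun, ZMod.card, Fintype.card_fin] at h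
    exact_mod_cast h
  calc _ ≤ ∑ v : Fin (k + 1) → ZMod 2 with v ≠ 0,
        ((Finset.univ.filter fun f => influence (k + 1) f v < 1 / 3).card : ℝ) := by
        exact_mod_cast (Finset.card_le_card hsub).trans Finset.card_biUnion_le
    _ ≤ ∑ v : Fin (k + 1) → ZMod 2 with v ≠ 0,
        (2 ^ 2 ^ (k + 1) * Real.exp (-(2 : ℝ) ^ k / 18)) :=
        Finset.sum_le_sum fun v hv => card_influence_lt_le (Finset.mem_filter.mp hv).2
    _ ≤ 2 ^ (k + 1) * (2 ^ 2 ^ (k + 1) * Real.exp (-(2 : ℝ) ^ k / 18)) := by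
        rw [Finset.sum_const, nsmul_eq_mul]
        gcongr
    _ = _ := by ring
end
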